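/- arXiv:1709.08895 — 2 statements merged into one kernel-verified Lean document; each statement's English description precedes it below -/
import Mathlib

section
/- Let X be a complex Hilbert space and let A be the generator of a bounded C₀-semigroup (T(t))_{t≥0} on X. Suppose that σ(A) ∩ iℝ = ∅ and that M : [0,∞) → (0,∞) is a continuous non-decreasing function of positive increase such that sup_{|r|≤s} ‖R(ir,A)‖ ≤ M(s) for all s ≥ 0. Then ‖T(t)A⁻¹‖ = O(1/M⁻¹(t)) as t → ∞, i.e. there exist C > 0 and t₀ such that ‖T(t)A⁻¹‖ ≤ C/M⁻¹(t) for all t ≥ t₀. -/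
open Filter Topology MeasureTheory

noncomputable section

/-- `T` is a (one-parameter) `C₀`-semigroup on `X`, indexed by `t ≥ 0`. -/
structure IsC0Semigroup {X : Type*} [NormedAddCommGroup X] [NormedSpace ℂ X]
    (T : ℝ → X →L[ℂ] X) : Prop where
  map_zero : T 0 = 1
  map_add : ∀ s t : ℝ, 0 ≤ s → 0 ≤ t → T (s + t) = T s ∘L T t
  strong_continuity : ∀ x : X, ContinuousOn (fun t => T t x) (Set.Ici (0 : ℝ))

/-- `A` (a closed, densely defined, partially defined linear operator) is the
infinitesimal generator of the semigroup `T`. -/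
structure IsGenerator {X : Type*} [NormedAddCommGroup X] [NormedSpace ℂ X]
    (T : ℝ → X →L[ℂ] X) (A : X →ₗ.[ℂ] X) : Prop where
  dense_domain : Dense (A.domain : Set X)
  mem_domain_iff : ∀ x : X, x ∈ A.domain ↔
    ∃ y : X, Tendsto (fun t : ℝ => t⁻¹ • (T t x - x)) (𝓝[>] (0 : ℝ)) (𝓝 y)
  tendsto_generator : ∀ x : A.domain,
    Tendsto (fun t : ℝ => t⁻¹ • (T t (x : X) - (x : X))) (𝓝[>] (0 : ℝ)) (𝓝 (A x))

/-- `R` is the resolvent operator `R(z, A) = (z I - A)⁻¹` of `A` at the point `z`;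
in particular `z` belongs to the resolvent set of `A`. -/
structure IsResolvent {X : Type*} [NormedAddCommGroup X] [NormedSpace ℂ X]
    (A : X →ₗ.[ℂ] X) (z : ℂ) (R : X →L[ℂ] X) : Prop where
  mem_domain : ∀ x : X, R x ∈ A.domain
  right_inv : ∀ x : X, z • R x - A ⟨R x, mem_domain x⟩ = x
  left_inv : ∀ x : A.domain, R (z • (x : X) - A x) = (x : X)

/-- The spectrum `σ(A)` of the partially defined operator `A`: the set of `z ∈ ℂ`
at which no (bounded, everywhere defined) resolvent operator for `A` exists. -/
def pmSpectrum {X : Type*} [NormedAddCommGroup X] [NormedSpace ℂ X]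
    (A : X →ₗ.[ℂ] X) : Set ℂ :=
  {z : ℂ | ¬∃ R : X →L[ℂ] X, IsResolvent A z R}

/-- `M : [a, ∞) → (0, ∞)` has positive increase: there are `α > 0`, `c ∈ (0,1]` and
`s₀ ≥ a` with `s₀ > 0` such that `M (λ s) / M s ≥ c λ^α` for all `λ ≥ 1`, `s ≥ s₀`. -/
def HasPosIncrease (a : ℝ) (M : ℝ → ℝ) : Prop :=
  ∃ α : ℝ, 0 < α ∧ ∃ c : ℝ, c ∈ Set.Ioc (0 : ℝ) 1 ∧ ∃ s₀ : ℝ, a ≤ s₀ ∧ 0 < s₀ ∧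
    ∀ lam : ℝ, 1 ≤ lam → ∀ s : ℝ, s₀ ≤ s → c * lam ^ α ≤ M (lam * s) / M s

/-- The right-continuous right-inverse `M⁻¹ t = sup {r ≥ a : M r ≤ t}` of a
continuous non-decreasing function `M` on `[a, ∞)` with `M s → ∞` as `s → ∞`. -/
def rcInv (a : ℝ) (M : ℝ → ℝ) (t : ℝ) : ℝ :=
  sSup {r : ℝ | a ≤ r ∧ M r ≤ t}

open FourierTransform SchwartzMap in
/-- Plancherel's theorem for integrable, square integrable functions with values in a
Hilbert space. -/
theorem eLpNorm_fourier_eq_of_integrable {X : Type*} [NormedAddCommGroup X]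
    [InnerProductSpace ℂ X] [CompleteSpace X] {f : ℝ → X} (hf : Integrable f)
    (hf2 : MemLp f 2) : eLpNorm (𝓕 f) 2 = eLpNorm f 2 := by
  set F : Lp X 2 (volume : Measure ℝ) := hf2.toLp f with hF
  have hcont : Continuous (𝓕 f) :=
    VectorFourier.fourierIntegral_continuous Real.continuous_fourierChar
      (by exact continuous_inner) hf
  have hae : ∀ᵐ x, (𝓕 F : Lp X 2 (volume : Measure ℝ)) x = 𝓕 f x := by
    apply ae_eq_of_integral_contDiff_smul_eq
    · exact (Lp.memLp (𝓕 F)).locallyIntegrable (by norm_num)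
    · exact hcont.locallyIntegrable
    intro g hg hgs
    have h1 : ContDiff ℝ (↑(⊤ : ℕ∞)) (fun x => (g x : ℂ)) :=
      Complex.ofRealCLM.contDiff.comp hg
    have h2 : HasCompactSupport (fun x => (g x : ℂ)) :=
      hgs.comp_left (g := fun y : ℝ => (y : ℂ)) Complex.ofReal_zero
    set φ : 𝓢(ℝ, ℂ) := h2.toSchwartzMap h1 with hφ
    have hφa : ∀ x, φ x = (g x : ℂ) := fun x => rfl
    have key := congrArg (fun D => D φ) (Lp.fourier_toTemperedDistribution_eq F)
    simp only [TemperedDistribution.fourier_apply, Lp.toTemperedDistribution_apply] at key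
    have e1 : ∫ x, g x • (𝓕 F : Lp X 2 (volume : Measure ℝ)) x
        = ∫ x, φ x • (𝓕 F : Lp X 2 (volume : Measure ℝ)) x := by
      simp only [hφa, Complex.coe_smul]
    have e2 : ∫ x, g x • 𝓕 f x = ∫ x, φ x • 𝓕 f x := by
      simp only [hφa, Complex.coe_smul]
    rw [e1, ← key, e2]
    have h3 := VectorFourier.integral_fourierIntegral_smul_eq_flip (L := innerₗ ℝ)
      (μ := (volume : Measure ℝ)) (ν := (volume : Measure ℝ)) (f := (φ : ℝ → ℂ)) (g := f)
      Real.continuous_fourierChar (by exact continuous_inner) φ.integrable hf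
    have h4 : ∫ x, (𝓕 φ) x • F x = ∫ x, (𝓕 φ) x • f x := by
      apply integral_congr_ae
      filter_upwards [hf2.coeFn_toLp] with x hx
      rw [hF, hx]
    rw [h4]
    rw [flip_innerₗ] at h3
    exact h3
  have h5 : eLpNorm (𝓕 f) 2 = eLpNorm (𝓕 F : Lp X 2 (volume : Measure ℝ)) 2 :=
    eLpNorm_congr_ae (hae.mono fun x hx => hx.symm)
  have h6 : eLpNorm f 2 = eLpNorm F 2 := eLpNorm_congr_ae hf2.coeFn_toLp.symm
  rw [h5, h6, ← Lp.enorm_def, ← Lp.enorm_def, enorm_eq_iff_norm_eq, Lp.norm_fourier_eq]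

section Semigroup

variable {X : Type*} [NormedAddCommGroup X] [InnerProductSpace ℂ X]
  {T : ℝ → X →L[ℂ] X} {A : X →ₗ.[ℂ] X}

theorem IsC0Semigroup.tendsto_quotient (hT : IsC0Semigroup T) (hA : IsGenerator T A)
    (z : A.domain) {s : ℝ} (hs : 0 ≤ s) :
    Tendsto (fun t : ℝ => t⁻¹ • (T t (T s z) - T s z)) (𝓝[>] (0 : ℝ)) (𝓝 (T s (A z))) := by
  refine (((T s).continuous.tendsto _).comp (hA.tendsto_generator z)).congr' ?_
  filter_upwards [self_mem_nhdsWithin] with t ht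
  have h1 := congrArg (fun L => L (z : X)) (hT.map_add t s (le_of_lt ht) hs)
  have h2 := congrArg (fun L => L (z : X)) (hT.map_add s t hs (le_of_lt ht))
  simp only [ContinuousLinearMap.comp_apply] at h1 h2
  rw [add_comm] at h1
  simp only [Function.comp_apply, ContinuousLinearMap.map_smul_of_tower, map_sub]
  rw [← h1, h2]

theorem IsC0Semigroup.mem_domain (hT : IsC0Semigroup T) (hA : IsGenerator T A)
    (z : A.domain) {s : ℝ} (hs : 0 ≤ s) : T s z ∈ A.domain :=
  (hA.mem_domain_iff _).2 ⟨_, hT.tendsto_quotient hA z hs⟩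

theorem IsC0Semigroup.generator_apply (hT : IsC0Semigroup T) (hA : IsGenerator T A)
    (z : A.domain) {s : ℝ} (hs : 0 ≤ s) : A ⟨T s z, hT.mem_domain hA z hs⟩ = T s (A z) :=
  tendsto_nhds_unique (hA.tendsto_generator ⟨T s z, hT.mem_domain hA z hs⟩)
    (hT.tendsto_quotient hA z hs)

/-- Resolvents of the generator commute with the semigroup. -/
theorem IsC0Semigroup.resolvent_comm (hT : IsC0Semigroup T) (hA : IsGenerator T A)
    {w : ℂ} {R : X →L[ℂ] X} (hR : IsResolvent A w R) (x : X) {s : ℝ} (hs : 0 ≤ s) :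
    R (T s x) = T s (R x) := by
  have h1 := hR.left_inv ⟨T s (R x), hT.mem_domain hA ⟨R x, hR.mem_domain x⟩ hs⟩
  have h2 := hT.generator_apply hA ⟨R x, hR.mem_domain x⟩ hs
  simp only at h1 h2
  rw [h2, ← map_smul, ← map_sub, hR.right_inv] at h1
  exact h1

theorem IsC0Semigroup.hasDerivWithinAt (hT : IsC0Semigroup T) (hA : IsGenerator T A)
    (z : A.domain) {s : ℝ} (hs : 0 ≤ s) :
    HasDerivWithinAt (fun u => T u z) (T s (A z)) (Set.Ioi s) s := by
  rw [hasDerivWithinAt_iff_tendsto_slope' (by simp)]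
  have h0 : Tendsto (fun u : ℝ => u - s) (𝓝[>] s) (𝓝[>] (0 : ℝ)) := by
    refine tendsto_nhdsWithin_iff.2 ⟨?_, ?_⟩
    · have : Tendsto (fun u : ℝ => u - s) (𝓝 s) (𝓝 (s - s)) :=
        (continuous_id.sub continuous_const).tendsto s
      rw [sub_self] at this
      exact this.mono_left nhdsWithin_le_nhds
    · filter_upwards [self_mem_nhdsWithin] with u hu
      exact sub_pos.2 (Set.mem_Ioi.1 hu)
  refine ((hT.tendsto_quotient hA z hs).comp h0).congr' ?_
  filter_upwards [self_mem_nhdsWithin] with u hu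
  have h1 := congrArg (fun L => L (z : X)) (hT.map_add (u - s) s (sub_pos.2 (Set.mem_Ioi.1 hu)).le hs)
  simp only [ContinuousLinearMap.comp_apply, sub_add_cancel] at h1
  simp [slope_def_module, h1]

/-- The integral `∫₀^∞ e^{-ws} s^m T(s) x ds`. -/
def momentLaplace (T : ℝ → X →L[ℂ] X) (m : ℕ) (w : ℂ) (x : X) : X :=
  ∫ s in Set.Ioi (0 : ℝ), (Complex.exp (-w * s) * (s : ℂ) ^ m) • T s x

theorem continuousOn_momentLaplace_integrand (hT : IsC0Semigroup T) (m : ℕ) (w : ℂ) (x : X) :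
    ContinuousOn (fun s : ℝ => (Complex.exp (-w * s) * (s : ℂ) ^ m) • T s x) (Set.Ici 0) := by
  refine ContinuousOn.smul (Continuous.continuousOn ?_) (hT.strong_continuity x)
  fun_prop

theorem norm_momentLaplace_integrand (m : ℕ) (w : ℂ) (x : X) {s : ℝ} (hs : 0 ≤ s) :
    ‖(Complex.exp (-w * s) * (s : ℂ) ^ m) • T s x‖ =
      Real.exp (-w.re * s) * s ^ m * ‖T s x‖ := by
  rw [norm_smul, norm_mul, Complex.norm_exp, norm_pow, Complex.norm_real,
    Real.norm_of_nonneg hs]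
  simp

theorem integrableOn_exp_mul_pow (m : ℕ) {b : ℝ} (hb : 0 < b) :
    IntegrableOn (fun s : ℝ => Real.exp (-b * s) * s ^ m) (Set.Ioi 0) := by
  have := integrableOn_rpow_mul_exp_neg_mul_rpow (s := m) (p := 1) (b := b)
    (by have := Nat.cast_nonneg (α := ℝ) m; linarith) one_pos hb
  refine this.congr_fun (fun s _ => ?_) measurableSet_Ioi
  simp [mul_comm]

theorem integrableOn_momentLaplace (hT : IsC0Semigroup T) {K : ℝ}
    (hK : ∀ t : ℝ, 0 ≤ t → ‖T t‖ ≤ K) (m : ℕ) {w : ℂ} (hw : 0 < w.re) (x : X) :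
    IntegrableOn (fun s : ℝ => (Complex.exp (-w * s) * (s : ℂ) ^ m) • T s x)
      (Set.Ioi 0) := by
  refine Integrable.mono' ((integrableOn_exp_mul_pow m hw).mul_const (K * ‖x‖))
    (((continuousOn_momentLaplace_integrand hT m w x).mono
      Set.Ioi_subset_Ici_self).aestronglyMeasurable measurableSet_Ioi) ?_
  filter_upwards [ae_restrict_mem measurableSet_Ioi] with s hs
  rw [norm_momentLaplace_integrand m w x (le_of_lt hs)]
  have hs' : (0 : ℝ) ≤ s := le_of_lt hs
  gcongr
  exact (T s).le_of_opNorm_le (hK s hs') x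

theorem momentLaplace_add (hT : IsC0Semigroup T) {K : ℝ}
    (hK : ∀ t : ℝ, 0 ≤ t → ‖T t‖ ≤ K) (m : ℕ) {w : ℂ} (hw : 0 < w.re) (x y : X) :
    momentLaplace T m w (x + y) = momentLaplace T m w x + momentLaplace T m w y := by
  simp only [momentLaplace, map_add, smul_add]
  exact integral_add (integrableOn_momentLaplace hT hK m hw x)
    (integrableOn_momentLaplace hT hK m hw y)

theorem momentLaplace_smul (m : ℕ) (w a : ℂ) (x : X) :
    momentLaplace T m w (a • x) = a • momentLaplace T m w x := by
  simp only [momentLaplace, map_smul]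
  rw [← integral_smul]
  simp only [smul_comm a]

theorem norm_momentLaplace_zero_le {K : ℝ}
    (hK : ∀ t : ℝ, 0 ≤ t → ‖T t‖ ≤ K) {w : ℂ} (hw : 0 < w.re) (x : X) :
    ‖momentLaplace T 0 w x‖ ≤ K / w.re * ‖x‖ := by
  have h : ‖momentLaplace T 0 w x‖ ≤
      ∫ s in Set.Ioi (0 : ℝ), Real.exp (-w.re * s) * s ^ 0 * (K * ‖x‖) := by
    refine norm_integral_le_of_norm_le
      ((integrableOn_exp_mul_pow 0 hw).mul_const (K * ‖x‖)) ?_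
    filter_upwards [ae_restrict_mem measurableSet_Ioi] with s hs
    have hs' : (0 : ℝ) ≤ s := le_of_lt hs
    rw [norm_momentLaplace_integrand 0 w x hs']
    gcongr
    exact (T s).le_of_opNorm_le (hK s hs') x
  rw [integral_mul_const] at h
  simp only [pow_zero, mul_one] at h
  rw [integral_exp_mul_Ioi (by linarith)] at h
  simp only [mul_zero, Real.exp_zero] at h
  calc _ ≤ _ := h
    _ = K / w.re * ‖x‖ := by field_simp

theorem memLp_two_momentLaplace_integrand (hT : IsC0Semigroup T) {K : ℝ}
    (hK : ∀ t : ℝ, 0 ≤ t → ‖T t‖ ≤ K) (m : ℕ) {w : ℂ} (hw : 0 < w.re) (x : X) :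
    MemLp (fun s : ℝ => (Complex.exp (-w * s) * (s : ℂ) ^ m) • T s x) 2
      (volume.restrict (Set.Ioi 0)) := by
  have hmeas := (integrableOn_momentLaplace hT hK m hw x).aestronglyMeasurable
  rw [memLp_two_iff_integrable_sq_norm hmeas]
  refine Integrable.mono' ((integrableOn_exp_mul_pow (2 * m) (b := 2 * w.re)
    (by positivity)).mul_const ((K * ‖x‖) ^ 2)) (hmeas.norm.pow 2) ?_
  filter_upwards [ae_restrict_mem measurableSet_Ioi] with s hs
  have hs' : (0 : ℝ) ≤ s := le_of_lt hs
  rw [norm_momentLaplace_integrand m w x hs', Real.norm_of_nonneg (by positivity)]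
  have h1 : Real.exp (-(2 * w.re) * s) = Real.exp (-w.re * s) ^ 2 := by
    rw [← Real.exp_nat_mul]; congr 1; push_cast; ring
  rw [h1, mul_comm 2 m, pow_mul, ← mul_pow, ← mul_pow]
  gcongr
  exact (T s).le_of_opNorm_le (hK s hs') x

theorem fourier_indicator_momentLaplace_integrand (m : ℕ) (w : ℂ) (x : X) (u : ℝ) :
    FourierTransform.fourier ((Set.Ioi (0 : ℝ)).indicator
      fun s : ℝ => (Complex.exp (-w * s) * (s : ℂ) ^ m) • T s x) u =
      momentLaplace T m (w + Complex.I * (2 * Real.pi * u : ℝ)) x := by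
  rw [Real.fourier_real_eq_integral_exp_smul, momentLaplace,
    ← integral_indicator measurableSet_Ioi]
  congr 1
  ext s
  by_cases hs : s ∈ Set.Ioi (0 : ℝ)
  · simp only [Set.indicator_of_mem hs, smul_smul, ← mul_assoc, ← Complex.exp_add]
    congr 3
    push_cast
    ring
  · simp only [Set.indicator_of_notMem hs, smul_zero]

variable [CompleteSpace X]

theorem resolvent_momentLaplace (hT : IsC0Semigroup T) (hA : IsGenerator T A) {K : ℝ}
    (hK : ∀ t : ℝ, 0 ≤ t → ‖T t‖ ≤ K) {v : ℂ} {R : X →L[ℂ] X} (hR : IsResolvent A v R)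
    (m : ℕ) {w : ℂ} (hw : 0 < w.re) (x : X) :
    R (momentLaplace T m w x) = momentLaplace T m w (R x) := by
  rw [momentLaplace, ← R.integral_comp_comm (integrableOn_momentLaplace hT hK m hw x)]
  refine setIntegral_congr_fun measurableSet_Ioi fun s hs => ?_
  simp only [map_smul]
  rw [hT.resolvent_comm hA hR x (le_of_lt hs)]

/-- Integration by parts for the integrals `∫₀^∞ e^{-ws} s^m T(s) z ds`. -/
theorem momentLaplace_sub_generator (hT : IsC0Semigroup T) (hA : IsGenerator T A) {K : ℝ}
    (hK : ∀ t : ℝ, 0 ≤ t → ‖T t‖ ≤ K) (m : ℕ) {w : ℂ} (hw : 0 < w.re) (z : A.domain) :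
    momentLaplace T m w (w • (z : X) - A z) =
      (m : ℂ) • momentLaplace T (m - 1) w z + (0 : ℂ) ^ m • (z : X) := by
  set G : ℝ → X := fun s => (Complex.exp (-w * s) * (s : ℂ) ^ m) • T s z with hG
  set G' : ℝ → X := fun s => (m : ℂ) • ((Complex.exp (-w * s) * (s : ℂ) ^ (m - 1)) • T s z)
    - (Complex.exp (-w * s) * (s : ℂ) ^ m) • T s (w • (z : X) - A z) with hG'
  have hi1 := integrableOn_momentLaplace hT hK (m - 1) hw (z : X)
  have hi2 := integrableOn_momentLaplace hT hK m hw (w • (z : X) - A z)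
  have hint : IntegrableOn G' (Set.Ioi 0) := (hi1.smul (m : ℂ)).sub hi2
  have hval : ∫ s in Set.Ioi (0 : ℝ), G' s = (m : ℂ) • momentLaplace T (m - 1) w z
      - momentLaplace T m w (w • (z : X) - A z) := by
    simp only [momentLaplace]
    rw [← integral_smul]
    exact integral_sub (hi1.smul (m : ℂ)) hi2
  have hderiv : ∀ s : ℝ, 0 ≤ s → HasDerivWithinAt G (G' s) (Set.Ioi s) s := by
    intro s hs
    have h1 : HasDerivAt (fun s : ℝ => Complex.exp (-w * s) * (s : ℂ) ^ m)
        (Complex.exp (-w * s) * (-w * 1) * (s : ℂ) ^ m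
          + Complex.exp (-w * s) * (m * (s : ℂ) ^ (m - 1) * 1)) s := by
      have hid : HasDerivAt (fun s : ℝ => (s : ℂ)) 1 s := Complex.ofRealCLM.hasDerivAt
      exact ((hid.const_mul (-w)).cexp).mul (hid.pow m)
    have h2 := h1.hasDerivWithinAt.smul (hT.hasDerivWithinAt hA z hs)
    refine h2.congr_deriv ?_
    simp only [hG', map_sub, map_smul]
    module
  have hFTC : ∀ b : ℝ, 0 ≤ b → ∫ s in (0 : ℝ)..b, G' s = G b - G 0 := by
    intro b hb
    refine intervalIntegral.integral_eq_sub_of_hasDeriv_right_of_le hb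
      ((continuousOn_momentLaplace_integrand hT m w z).mono Set.Icc_subset_Ici_self)
      (fun s hs => hderiv s hs.1.le) ?_
    rw [intervalIntegrable_iff_integrableOn_Ioc_of_le hb]
    exact hint.mono_set Set.Ioc_subset_Ioi_self
  have hlim : Tendsto G atTop (𝓝 0) := by
    have h1 : Tendsto (fun s : ℝ => Real.exp (-w.re * s) * s ^ m * (K * ‖(z : X)‖)) atTop
        (𝓝 (0 * (K * ‖(z : X)‖))) := by
      refine Tendsto.mul_const _ ?_
      have := tendsto_rpow_mul_exp_neg_mul_atTop_nhds_zero m w.re hw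
      refine this.congr fun s => ?_
      rw [Real.rpow_natCast, mul_comm]
    rw [zero_mul] at h1
    refine squeeze_zero_norm' ?_ h1
    filter_upwards [eventually_ge_atTop 0] with s hs
    simp only [hG]
    rw [norm_momentLaplace_integrand m w (z : X) hs]
    gcongr
    exact (T s).le_of_opNorm_le (hK s hs) z
  have h3 : Tendsto (fun b : ℝ => ∫ s in (0 : ℝ)..b, G' s) atTop (𝓝 (0 - G 0)) := by
    refine (hlim.sub_const (G 0)).congr' ?_
    filter_upwards [eventually_ge_atTop 0] with b hb
    exact (hFTC b hb).symm
  have h4 := tendsto_nhds_unique h3 (intervalIntegral_tendsto_integral_Ioi 0 hint tendsto_id)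
  have hG0 : G 0 = (0 : ℂ) ^ m • (z : X) := by simp [hG, hT.map_zero]
  rw [hval, hG0, zero_sub] at h4
  rw [eq_sub_iff_add_eq, neg_add_eq_iff_eq_add] at h4
  rw [h4, add_comm]

/-- For `Re w > 0`, the Laplace transform of the semigroup inverts `w - A`. -/
theorem momentLaplace_zero_add_resolvent (hT : IsC0Semigroup T) (hA : IsGenerator T A) {K : ℝ}
    (hK : ∀ t : ℝ, 0 ≤ t → ‖T t‖ ≤ K) {v w : ℂ} {R : X →L[ℂ] X} (hR : IsResolvent A v R)
    (hw : 0 < w.re) (x : X) :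
    momentLaplace T 0 w (x + (w - v) • R x) = R x := by
  have h := momentLaplace_sub_generator hT hA hK 0 hw ⟨R x, hR.mem_domain x⟩
  have h2 := hR.right_inv x
  rw [sub_eq_iff_eq_add] at h2
  have h3 : w • R x - A ⟨R x, hR.mem_domain x⟩ = x + (w - v) • R x := by
    rw [sub_smul, h2]
    abel
  simpa [h3] using h

theorem momentLaplace_succ (hT : IsC0Semigroup T) (hA : IsGenerator T A) {K : ℝ}
    (hK : ∀ t : ℝ, 0 ≤ t → ‖T t‖ ≤ K) {v w : ℂ} {R : X →L[ℂ] X} (hR : IsResolvent A v R)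
    (hw : 0 < w.re) (m : ℕ) (x : X) :
    momentLaplace T (m + 1) w x =
      ((m : ℂ) + 1) • momentLaplace T 0 w (momentLaplace T m w x) := by
  have h := momentLaplace_sub_generator hT hA hK (m + 1) hw ⟨R x, hR.mem_domain x⟩
  have h2 := hR.right_inv x
  rw [sub_eq_iff_eq_add] at h2
  have h3 : w • R x - A ⟨R x, hR.mem_domain x⟩ = x + (w - v) • R x := by
    rw [sub_smul, h2]
    abel
  simp only [h3, Nat.add_sub_cancel, pow_succ, mul_zero, zero_smul, add_zero] at h
  rw [momentLaplace_add hT hK _ hw, momentLaplace_smul,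
    ← resolvent_momentLaplace hT hA hK hR _ hw, ← resolvent_momentLaplace hT hA hK hR _ hw] at h
  have h4 := momentLaplace_zero_add_resolvent hT hA hK hR hw (momentLaplace T m w x)
  rw [momentLaplace_add hT hK _ hw, momentLaplace_smul,
    ← resolvent_momentLaplace hT hA hK hR _ hw] at h4
  set d := momentLaplace T (m + 1) w x -
    ((m : ℂ) + 1) • momentLaplace T 0 w (momentLaplace T m w x) with hd
  have h5 : d + (w - v) • R d = 0 := by
    rw [hd, map_sub, map_smul]
    push_cast at h
    rw [← h4] at h
    rw [← sub_eq_zero] at h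
    rw [← h]
    module
  have h6 := momentLaplace_zero_add_resolvent hT hA hK hR hw d
  rw [h5] at h6
  have h7 : momentLaplace T 0 w (0 : X) = 0 := by simp [momentLaplace]
  rw [← h6, h7, smul_zero, add_zero] at h5
  exact sub_eq_zero.1 h5

theorem norm_momentLaplace_zero_le_of_resolvent (hT : IsC0Semigroup T) (hA : IsGenerator T A)
    {K : ℝ} (hK : ∀ t : ℝ, 0 ≤ t → ‖T t‖ ≤ K) {w : ℂ} {R : X →L[ℂ] X}
    (hR : IsResolvent A (Complex.I * w.im) R) (hw : 0 < w.re) (x : X) :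
    ‖momentLaplace T 0 w x‖ ≤ (1 + K) * ‖R‖ * ‖x‖ := by
  have h := momentLaplace_zero_add_resolvent hT hA hK hR hw x
  have hwv : w - Complex.I * w.im = (w.re : ℂ) := by
    apply Complex.ext <;> simp
  rw [hwv, momentLaplace_add hT hK _ hw, momentLaplace_smul] at h
  have h2 : momentLaplace T 0 w x = R x - (w.re : ℂ) • momentLaplace T 0 w (R x) :=
    eq_sub_of_add_eq h
  have h3 := norm_momentLaplace_zero_le hK hw (R x)
  calc ‖momentLaplace T 0 w x‖ ≤ ‖R x‖ + w.re * ‖momentLaplace T 0 w (R x)‖ := by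
        rw [h2]
        refine (norm_sub_le _ _).trans_eq ?_
        rw [norm_smul, Complex.norm_real, Real.norm_of_nonneg hw.le]
    _ ≤ ‖R x‖ + w.re * (K / w.re * ‖R x‖) := by gcongr
    _ = (1 + K) * ‖R x‖ := by field_simp
    _ ≤ (1 + K) * (‖R‖ * ‖x‖) := by
        have : 0 ≤ K := (norm_nonneg _).trans (hK 0 le_rfl)
        gcongr
        exact R.le_opNorm x
    _ = _ := by ring

/-- The moments of the semigroup are controlled by powers of the resolvent. -/
theorem norm_momentLaplace_resolvent_le (hT : IsC0Semigroup T) (hA : IsGenerator T A)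
    {K : ℝ} (hK : ∀ t : ℝ, 0 ≤ t → ‖T t‖ ≤ K) {v w : ℂ} {R : X →L[ℂ] X}
    (hR : IsResolvent A v R) (hw : 0 < w.re) {B D : ℝ} (hB0 : 0 ≤ B)
    (hB : ∀ x, ‖momentLaplace T 0 w x‖ ≤ B * ‖x‖)
    (hD : ∀ x, ‖momentLaplace T 0 w (R x)‖ ≤ D * ‖x‖) (m : ℕ) (x : X) :
    ‖momentLaplace T (m + 1) w (R x)‖ ≤
      (m + 1).factorial * B ^ m * D * ‖momentLaplace T 0 w x‖ := by
  induction m with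
  | zero =>
    rw [momentLaplace_succ hT hA hK hR hw, ← resolvent_momentLaplace hT hA hK hR 0 hw]
    simpa using hD _
  | succ m ih =>
    rw [momentLaplace_succ hT hA hK hR hw, norm_smul]
    have h1 : ‖((m + 1 : ℕ) : ℂ) + 1‖ = (m : ℝ) + 2 := by
      have : ((m + 1 : ℕ) : ℂ) + 1 = ((m + 2 : ℕ) : ℂ) := by push_cast; ring
      rw [this, Complex.norm_natCast]; push_cast; ring
    rw [h1]
    calc _ ≤ ((m : ℝ) + 2) * (B * ((m + 1).factorial * B ^ m * D *
          ‖momentLaplace T 0 w x‖)) := by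
          gcongr
          exact (hB _).trans (by gcongr)
      _ = _ := by
          rw [Nat.factorial_succ (m + 1)]
          push_cast
          ring

theorem norm_momentLaplace_zero_inverse_le (hT : IsC0Semigroup T) (hA : IsGenerator T A)
    {K : ℝ} (hK : ∀ t : ℝ, 0 ≤ t → ‖T t‖ ≤ K) {w : ℂ} {R : X →L[ℂ] X}
    (hR : IsResolvent A 0 R) (hw : 0 < w.re) {B r : ℝ} (hr : 0 < r) (hrw : r ≤ |w.im|)
    (hB : ∀ x, ‖momentLaplace T 0 w x‖ ≤ B * ‖x‖) (x : X) :
    ‖momentLaplace T 0 w (R x)‖ ≤ (B + ‖R‖) / r * ‖x‖ := by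
  have h := momentLaplace_zero_add_resolvent hT hA hK hR hw x
  rw [sub_zero, momentLaplace_add hT hK _ hw, momentLaplace_smul] at h
  have h2 : w • momentLaplace T 0 w (R x) = R x - momentLaplace T 0 w x :=
    eq_sub_of_add_eq' h
  have h3 : r * ‖momentLaplace T 0 w (R x)‖ ≤ (B + ‖R‖) * ‖x‖ :=
    calc r * ‖momentLaplace T 0 w (R x)‖ ≤ ‖w‖ * ‖momentLaplace T 0 w (R x)‖ := by
          gcongr
          exact hrw.trans (Complex.abs_im_le_norm w)
      _ = ‖R x - momentLaplace T 0 w x‖ := by rw [← norm_smul, h2]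
      _ ≤ ‖R‖ * ‖x‖ + B * ‖x‖ := (norm_sub_le _ _).trans (add_le_add (R.le_opNorm x) (hB x))
      _ = _ := by ring
  rw [div_mul_eq_mul_div, le_div_iff₀ hr, mul_comm]
  exact h3

/-- Plancherel's theorem turns a bound between Laplace transforms on a vertical line into a
bound between weighted `L²`-norms of orbits. -/
theorem integral_norm_sq_le_of_momentLaplace_le (hT : IsC0Semigroup T) {K : ℝ}
    (hK : ∀ t : ℝ, 0 ≤ t → ‖T t‖ ≤ K) {m n : ℕ} {w : ℂ} (hw : 0 < w.re) {x y : X} {S : ℝ}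
    (hS : 0 ≤ S) (h : ∀ v : ℂ, v.re = w.re → ‖momentLaplace T m v y‖ ≤
      S * ‖momentLaplace T n v x‖) :
    ∫ s in Set.Ioi (0 : ℝ), ‖(Complex.exp (-w * s) * (s : ℂ) ^ m) • T s y‖ ^ 2 ≤
      S ^ 2 * ∫ s in Set.Ioi (0 : ℝ), ‖(Complex.exp (-w * s) * (s : ℂ) ^ n) • T s x‖ ^ 2 := by
  have hL1 : ∀ (k : ℕ) (z : X), Integrable ((Set.Ioi (0 : ℝ)).indicator
      fun s : ℝ => (Complex.exp (-w * s) * (s : ℂ) ^ k) • T s z) := fun k z =>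
    (integrableOn_momentLaplace hT hK k hw z).integrable_indicator measurableSet_Ioi
  have hL2 : ∀ (k : ℕ) (z : X), MemLp ((Set.Ioi (0 : ℝ)).indicator
      fun s : ℝ => (Complex.exp (-w * s) * (s : ℂ) ^ k) • T s z) 2 := fun k z =>
    (memLp_indicator_iff_restrict measurableSet_Ioi).2
      (memLp_two_momentLaplace_integrand hT hK k hw z)
  have hsq : ∀ (k : ℕ) (z : X), eLpNorm ((Set.Ioi (0 : ℝ)).indicator
      fun s : ℝ => (Complex.exp (-w * s) * (s : ℂ) ^ k) • T s z) 2 =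
      ENNReal.ofReal (Real.sqrt (∫ s in Set.Ioi (0 : ℝ),
        ‖(Complex.exp (-w * s) * (s : ℂ) ^ k) • T s z‖ ^ 2)) := by
    intro k z
    rw [eLpNorm_indicator_eq_eLpNorm_restrict measurableSet_Ioi,
      (memLp_two_momentLaplace_integrand hT hK k hw z).eLpNorm_eq_integral_rpow_norm
        (by norm_num) (by norm_num), Real.sqrt_eq_rpow]
    simp
  have hle : eLpNorm (FourierTransform.fourier ((Set.Ioi (0 : ℝ)).indicator
      fun s : ℝ => (Complex.exp (-w * s) * (s : ℂ) ^ m) • T s y)) 2 volume ≤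
      ENNReal.ofReal S * eLpNorm (FourierTransform.fourier ((Set.Ioi (0 : ℝ)).indicator
      fun s : ℝ => (Complex.exp (-w * s) * (s : ℂ) ^ n) • T s x)) 2 volume := by
    refine eLpNorm_le_mul_eLpNorm_of_ae_le_mul (Eventually.of_forall fun u => ?_) 2
    rw [fourier_indicator_momentLaplace_integrand, fourier_indicator_momentLaplace_integrand]
    exact h _ (by simp)
  rw [eLpNorm_fourier_eq_of_integrable (hL1 _ _) (hL2 _ _),
    eLpNorm_fourier_eq_of_integrable (hL1 _ _) (hL2 _ _), hsq, hsq, ← ENNReal.ofReal_mul hS,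
    ENNReal.ofReal_le_ofReal_iff (by positivity)] at hle
  have hnn : ∀ (k : ℕ) (z : X), 0 ≤ ∫ s in Set.Ioi (0 : ℝ),
      ‖(Complex.exp (-w * s) * (s : ℂ) ^ k) • T s z‖ ^ 2 := fun k z =>
    integral_nonneg fun s => by positivity
  have := pow_le_pow_left₀ (Real.sqrt_nonneg _) hle 2
  rwa [mul_pow, Real.sq_sqrt (hnn _ _), Real.sq_sqrt (hnn _ _)] at this

theorem norm_semigroup_le_of_momentLaplace_le (hT : IsC0Semigroup T) {K : ℝ}
    (hK : ∀ t : ℝ, 0 ≤ t → ‖T t‖ ≤ K) {m : ℕ} {t : ℝ} (ht : 0 < t) {x y : X} {S : ℝ}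
    (hS : 0 ≤ S) (h : ∀ v : ℂ, v.re = t⁻¹ → ‖momentLaplace T m v y‖ ≤
      S * ‖momentLaplace T 0 v x‖) :
    ‖T t y‖ * (t / 2) ^ m ≤ Real.exp 1 * K ^ 2 * S * ‖x‖ := by
  have hK0 : 0 ≤ K := (norm_nonneg _).trans (hK 0 le_rfl)
  have hw : 0 < ((t⁻¹ : ℝ) : ℂ).re := by simpa using ht
  have key := integral_norm_sq_le_of_momentLaplace_le hT hK hw hS (by simpa using h)
  have hupper : ∫ s in Set.Ioi (0 : ℝ),
      ‖(Complex.exp (-((t⁻¹ : ℝ) : ℂ) * s) * (s : ℂ) ^ 0) • T s x‖ ^ 2 ≤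
      (K * ‖x‖) ^ 2 * (t / 2) := by
    have h1 : ∫ s in Set.Ioi (0 : ℝ), Real.exp (-(2 / t) * s) * (K * ‖x‖) ^ 2 =
        (K * ‖x‖) ^ 2 * (t / 2) := by
      rw [integral_mul_const, integral_exp_mul_Ioi (by simpa using ht)]
      simp
      ring
    have h0 := integrableOn_exp_mul_pow 0 (b := 2 / t) (by positivity)
    simp only [pow_zero, mul_one] at h0
    rw [← h1]
    refine setIntegral_mono_on
      ((memLp_two_momentLaplace_integrand hT hK 0 hw x).integrable_norm_pow two_ne_zero)
      (h0.mul_const _) measurableSet_Ioi fun s hs => ?_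
    have hs' : (0 : ℝ) ≤ s := le_of_lt hs
    rw [norm_momentLaplace_integrand 0 _ x hs', pow_zero, mul_one, mul_pow]
    have h2 : Real.exp (-(2 / t) * s) = Real.exp (-((t⁻¹ : ℝ) : ℂ).re * s) ^ 2 := by
      rw [← Real.exp_nat_mul]; congr 1; simp; ring
    rw [h2]
    gcongr
    exact (T s).le_of_opNorm_le (hK s hs') x
  have hlower : (Real.exp (-1) * (t / 2) ^ m * ‖T t y‖) ^ 2 * (t / 2) ≤
      K ^ 2 * ∫ s in Set.Ioi (0 : ℝ),
        ‖(Complex.exp (-((t⁻¹ : ℝ) : ℂ) * s) * (s : ℂ) ^ m) • T s y‖ ^ 2 := by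
    have hint := (memLp_two_momentLaplace_integrand hT hK m hw y).integrable_norm_pow
      two_ne_zero
    rw [← integral_const_mul]
    have hsub : Set.Ioc (t / 2) t ⊆ Set.Ioi 0 := fun s hs =>
      lt_trans (half_pos ht) hs.1
    have hint2 : IntegrableOn (fun s : ℝ =>
        K ^ 2 * ‖(Complex.exp (-((t⁻¹ : ℝ) : ℂ) * s) * (s : ℂ) ^ m) • T s y‖ ^ 2)
        (Set.Ioi 0) := hint.const_mul _
    refine le_trans ?_ (setIntegral_mono_set hint2
      (Eventually.of_forall fun s => by positivity) hsub.eventuallyLE)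
    have h1 : (Real.exp (-1) * (t / 2) ^ m * ‖T t y‖) ^ 2 * (t / 2) =
        ∫ s in Set.Ioc (t / 2) t, (Real.exp (-1) * (t / 2) ^ m * ‖T t y‖) ^ 2 := by
      rw [setIntegral_const, smul_eq_mul, Real.volume_real_Ioc_of_le (by linarith)]
      ring
    rw [h1]
    refine setIntegral_mono_on (integrable_const _) (hint2.mono_set hsub)
      measurableSet_Ioc fun s hs => ?_
    have hs' : (0 : ℝ) ≤ s := le_of_lt (hsub hs)
    rw [norm_momentLaplace_integrand m _ y hs', ← mul_pow]
    have h3 : ‖T t y‖ ≤ K * ‖T s y‖ := by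
      have h4 := congrArg (fun L => L y) (hT.map_add (t - s) s (sub_nonneg.2 hs.2) hs')
      simp only [sub_add_cancel, ContinuousLinearMap.comp_apply] at h4
      rw [h4]
      exact (T (t - s)).le_of_opNorm_le (hK _ (sub_nonneg.2 hs.2)) _
    have h5 : Real.exp (-1) ≤ Real.exp (-((t⁻¹ : ℝ) : ℂ).re * s) := by
      apply Real.exp_le_exp.2
      rw [Complex.ofReal_re, neg_mul, neg_le_neg_iff, inv_mul_le_iff₀ ht, mul_one]
      exact hs.2
    refine pow_le_pow_left₀ (by positivity) ?_ 2
    calc Real.exp (-1) * (t / 2) ^ m * ‖T t y‖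
        ≤ Real.exp (-((t⁻¹ : ℝ) : ℂ).re * s) * s ^ m * (K * ‖T s y‖) := by
          gcongr
          exact hs.1.le
      _ = _ := by ring
  have hfin : (Real.exp (-1) * (t / 2) ^ m * ‖T t y‖) ^ 2 * (t / 2) ≤
      (K ^ 2 * S * ‖x‖) ^ 2 * (t / 2) :=
    calc _ ≤ _ := hlower
      _ ≤ K ^ 2 * (S ^ 2 * ((K * ‖x‖) ^ 2 * (t / 2))) := by
        gcongr
        exact key.trans (by gcongr)
      _ = _ := by ring
  have hfin2 := le_of_mul_le_mul_right hfin (half_pos ht)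
  have hfin3 := (pow_le_pow_iff_left₀ (by positivity) (by positivity) two_ne_zero).1 hfin2
  calc ‖T t y‖ * (t / 2) ^ m
      = Real.exp 1 * (Real.exp (-1) * (t / 2) ^ m * ‖T t y‖) := by
        rw [← mul_assoc, ← mul_assoc, ← Real.exp_add]
        simp [mul_comm]
    _ ≤ Real.exp 1 * (K ^ 2 * S * ‖x‖) := by gcongr
    _ = _ := by ring

end Semigroup

/-- For a function of positive increase, the right-inverse at a large `t` is attained. -/
theorem rcInv_spec {M : ℝ → ℝ} (hMpos : ∀ s : ℝ, 0 ≤ s → 0 < M s)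
    (hMcont : ContinuousOn M (Set.Ici (0 : ℝ))) {α c s₀ t : ℝ} (hα : 0 < α) (hc : 0 < c)
    (hs₀ : 0 < s₀)
    (hinc : ∀ lam : ℝ, 1 ≤ lam → ∀ s : ℝ, s₀ ≤ s → c * lam ^ α ≤ M (lam * s) / M s)
    (ht : M s₀ ≤ t) : s₀ ≤ rcInv 0 M t ∧ M (rcInv 0 M t) ≤ t := by
  have hM0 := hMpos s₀ hs₀.le
  have ht0 : 0 < t := hM0.trans_le ht
  have hmem : s₀ ∈ {r : ℝ | 0 ≤ r ∧ M r ≤ t} := ⟨hs₀.le, ht⟩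
  have hbdd : BddAbove {r : ℝ | 0 ≤ r ∧ M r ≤ t} := by
    refine ⟨max s₀ ((t / (c * M s₀)) ^ (1 / α) * s₀), fun r hr => ?_⟩
    rcases le_total r s₀ with h | h
    · exact le_max_of_le_left h
    apply le_max_of_le_right
    have h1 := hinc (r / s₀) ((one_le_div hs₀).2 h) s₀ le_rfl
    rw [div_mul_cancel₀ _ hs₀.ne', le_div_iff₀ hM0] at h1
    have h2 : (r / s₀) ^ α ≤ t / (c * M s₀) := by
      rw [le_div_iff₀ (by positivity)]
      calc _ = c * (r / s₀) ^ α * M s₀ := by ring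
        _ ≤ t := h1.trans hr.2
    have h3 : 0 ≤ r / s₀ := div_nonneg hr.1 hs₀.le
    have h4 := Real.rpow_le_rpow (by positivity) h2 (z := 1 / α) (by positivity)
    rw [← Real.rpow_mul h3, mul_one_div_cancel hα.ne', Real.rpow_one] at h4
    exact (div_le_iff₀ hs₀).1 h4
  have hclosed : IsClosed {r : ℝ | 0 ≤ r ∧ M r ≤ t} :=
    hMcont.preimage_isClosed_of_isClosed isClosed_Ici isClosed_Iic
  exact ⟨le_csSup hbdd hmem, (hclosed.csSup_mem ⟨s₀, hmem⟩ hbdd).2⟩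

theorem pow_div_le_of_rpow_growth {a b α c s R t : ℝ} {n : ℕ} (hα : 1 ≤ α * n) (hc : 0 < c)
    (hs : 0 < s) (hsR : s ≤ R) (ha : 0 < a) (hbt : b ≤ t) (h : c * (R / s) ^ α ≤ b / a) :
    a ^ n / s ≤ (t / c) ^ n / R := by
  have hR : 0 < R := hs.trans_le hsR
  have hRs : 1 ≤ R / s := (one_le_div hs).2 hsR
  have h1 : a * (R / s) ^ α ≤ t / c := by
    rw [le_div_iff₀ ha] at h
    rw [le_div_iff₀ hc]
    calc _ = c * (R / s) ^ α * a := by ring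
      _ ≤ t := h.trans hbt
  have h2 : R / s ≤ ((R / s) ^ α) ^ n := by
    rw [← Real.rpow_natCast, ← Real.rpow_mul (by positivity)]
    simpa using Real.rpow_le_rpow_of_exponent_le hRs hα
  rw [le_div_iff₀ hR]
  calc a ^ n / s * R = a ^ n * (R / s) := by ring
    _ ≤ a ^ n * ((R / s) ^ α) ^ n := by gcongr
    _ = (a * (R / s) ^ α) ^ n := by rw [mul_pow]
    _ ≤ _ := by gcongr

/-- Let `X` be a complex Hilbert space and `A` the generator of a
bounded `C₀`-semigroup `(T(t))` on `X`. Suppose `σ(A) ∩ iℝ = ∅` (i.e. every `i r`,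
`r ∈ ℝ`, has a resolvent operator `R(i r, A) = Rop r`) and that `M : [0,∞) → (0,∞)` is a
continuous non-decreasing function of positive increase with `sup_{|r| ≤ s} ‖R(i r, A)‖ ≤ M s`
for all `s ≥ 0`. Then `‖T(t) A⁻¹‖ = O(1 / M⁻¹ t)` as `t → ∞`.
(Note `A⁻¹ = -R(0, A)`.) -/
theorem statement3 {X : Type*} [NormedAddCommGroup X] [InnerProductSpace ℂ X]
    [CompleteSpace X]
    (T : ℝ → X →L[ℂ] X) (hT : IsC0Semigroup T)
    (hTbdd : ∃ K : ℝ, ∀ t : ℝ, 0 ≤ t → ‖T t‖ ≤ K)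
    (A : X →ₗ.[ℂ] X) (hA : IsGenerator T A)
    (Rop : ℝ → X →L[ℂ] X)
    (hRop : ∀ r : ℝ, IsResolvent A (Complex.I * (r : ℂ)) (Rop r))
    (M : ℝ → ℝ)
    (hMpos : ∀ s : ℝ, 0 ≤ s → 0 < M s)
    (hMcont : ContinuousOn M (Set.Ici (0 : ℝ)))
    (hMmono : ∀ s t : ℝ, 0 ≤ s → s ≤ t → M s ≤ M t)
    (hMpi : HasPosIncrease 0 M)
    (hres : ∀ s : ℝ, 0 ≤ s → ∀ r : ℝ, |r| ≤ s → ‖Rop r‖ ≤ M s) :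
    ∃ C : ℝ, 0 < C ∧ ∃ t₀ : ℝ, ∀ t : ℝ, t₀ ≤ t →
      ‖T t ∘L (-(Rop 0))‖ ≤ C / rcInv 0 M t := by
  obtain ⟨K, hK⟩ := hTbdd
  obtain ⟨α, hα, c, ⟨hc, -⟩, s₀, -, hs₀, hinc⟩ := hMpi
  obtain ⟨m, hm⟩ := exists_nat_ge (1 / α)
  have hK0 : 0 ≤ K := (norm_nonneg _).trans (hK 0 le_rfl)
  have hαm : 1 ≤ α * ((m + 1 : ℕ) : ℝ) := by
    rw [div_le_iff₀ hα] at hm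
    push_cast
    nlinarith
  have hR0 : IsResolvent A 0 (Rop 0) := by simpa using hRop 0
  set N : ℝ := ‖Rop 0‖ with hN
  have hN0 : 0 ≤ N := norm_nonneg _
  set C₂ : ℝ := (1 + K) ^ m * ((2 + K) * (1 + N * s₀)) * c⁻¹ ^ (m + 1) + (K + 1) ^ (m + 1)
    with hC₂
  have hC₂0 : 0 < C₂ := by positivity
  refine ⟨Real.exp 1 * K ^ 2 * ((m + 1).factorial * C₂) * 2 ^ (m + 1) + 1, by positivity,
    M s₀, fun t ht => ?_⟩
  have ht0 : 0 < t := (hMpos s₀ hs₀.le).trans_le ht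
  obtain ⟨hsR, hMR⟩ := rcInv_spec hMpos hMcont hα hc hs₀ hinc ht
  set R := rcInv 0 M t with hRdef
  have hR : 0 < R := hs₀.trans_le hsR
  have hNM : ∀ s, 0 ≤ s → N ≤ M s := fun s hs => hres s hs 0 (by simpa using hs)
  have hgrow : ∀ s, s₀ ≤ s → s ≤ R → M s ^ (m + 1) / s ≤ (t / c) ^ (m + 1) / R := by
    intro s hs hsR'
    have hs0 : 0 < s := hs₀.trans_le hs
    refine pow_div_le_of_rpow_growth hαm hc hs0 hsR' (hMpos s hs0.le) hMR ?_
    have := hinc (R / s) ((one_le_div hs0).2 hsR') s hs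
    rwa [div_mul_cancel₀ _ hs0.ne'] at this
  have hlow : ∀ s, s₀ ≤ s → s ≤ R → ∀ B D : ℝ, 0 ≤ B → B ≤ (1 + K) * M s →
      D ≤ (2 + K) * (1 + N * s₀) * (M s / s) → B ^ m * D ≤ C₂ * (t ^ (m + 1) / R) := by
    intro s hs hsR' B D hB0 hB hD
    have hs0 : 0 < s := hs₀.trans_le hs
    have hMs := hMpos s hs0.le
    calc B ^ m * D ≤ B ^ m * ((2 + K) * (1 + N * s₀) * (M s / s)) := by gcongr
      _ ≤ ((1 + K) * M s) ^ m * ((2 + K) * (1 + N * s₀) * (M s / s)) := by gcongr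
      _ = (1 + K) ^ m * ((2 + K) * (1 + N * s₀)) * (M s ^ (m + 1) / s) := by
        rw [mul_pow]; ring
      _ ≤ (1 + K) ^ m * ((2 + K) * (1 + N * s₀)) * ((t / c) ^ (m + 1) / R) :=
        mul_le_mul_of_nonneg_left (hgrow s hs hsR') (by positivity)
      _ = (1 + K) ^ m * ((2 + K) * (1 + N * s₀)) * c⁻¹ ^ (m + 1) * (t ^ (m + 1) / R) := by
        rw [div_eq_mul_inv t c, mul_pow]; ring
      _ ≤ _ := by
        rw [hC₂]
        gcongr
        exact le_add_of_nonneg_right (by positivity)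
  have hmain : ∀ x : X, ∀ w : ℂ, w.re = t⁻¹ → ‖momentLaplace T (m + 1) w (Rop 0 x)‖ ≤
      ((m + 1).factorial * C₂ * (t ^ (m + 1) / R)) * ‖momentLaplace T 0 w x‖ := by
    intro x w hwt
    have hw : 0 < w.re := by rw [hwt]; positivity
    suffices hBD : ∃ B D : ℝ, 0 ≤ B ∧ (∀ x, ‖momentLaplace T 0 w x‖ ≤ B * ‖x‖) ∧
        (∀ x, ‖momentLaplace T 0 w (Rop 0 x)‖ ≤ D * ‖x‖) ∧
        B ^ m * D ≤ C₂ * (t ^ (m + 1) / R) by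
      obtain ⟨B, D, hB0, hB, hD, hle⟩ := hBD
      refine (norm_momentLaplace_resolvent_le hT hA hK hR0 hw hB0 hB hD m x).trans ?_
      rw [mul_assoc _ (B ^ m) D, mul_assoc _ C₂]
      gcongr
    have hBM : ∀ s, |w.im| ≤ s → ∀ x, ‖momentLaplace T 0 w x‖ ≤ (1 + K) * M s * ‖x‖ := by
      intro s hs x
      refine (norm_momentLaplace_zero_le_of_resolvent hT hA hK (hRop w.im) hw x).trans ?_
      gcongr
      exact hres s ((abs_nonneg _).trans hs) _ hs
    rcases le_total R |w.im| with hwR | hwR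
    · have hB : ∀ x, ‖momentLaplace T 0 w x‖ ≤ K * t * ‖x‖ := by
        intro x
        simpa [hwt] using norm_momentLaplace_zero_le hK hw x
      refine ⟨K * t, (K * t + N) / R, by positivity, hB,
        norm_momentLaplace_zero_inverse_le hT hA hK hR0 hw hR hwR hB, ?_⟩
      have hNt : N ≤ t := (hNM s₀ hs₀.le).trans ht
      calc (K * t) ^ m * ((K * t + N) / R)
          ≤ ((K + 1) * t) ^ m * ((K * t + t) / R) := by
            gcongr
            linarith
        _ = (K + 1) ^ (m + 1) * (t ^ (m + 1) / R) := by rw [mul_pow]; ring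
        _ ≤ _ := by
          rw [hC₂]
          gcongr
          exact le_add_of_nonneg_left (by positivity)
    rcases le_total s₀ |w.im| with hws | hws
    · have hpos : 0 < |w.im| := hs₀.trans_le hws
      have hMp := hMpos _ hpos.le
      refine ⟨(1 + K) * M |w.im|, ((1 + K) * M |w.im| + N) / |w.im|, by positivity,
        hBM _ le_rfl, norm_momentLaplace_zero_inverse_le hT hA hK hR0 hw hpos le_rfl
        (hBM _ le_rfl), hlow |w.im| hws hwR _ _ (by positivity) le_rfl ?_⟩
      have hNs : 0 ≤ N * s₀ := by positivity
      calc ((1 + K) * M |w.im| + N) / |w.im|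
          ≤ ((1 + K) * M |w.im| + M |w.im|) / |w.im| := by
            gcongr
            exact hNM _ hpos.le
        _ = (2 + K) * 1 * (M |w.im| / |w.im|) := by ring
        _ ≤ _ := by
          gcongr
          linarith
    · have hMp := hMpos _ hs₀.le
      refine ⟨(1 + K) * M s₀, (1 + K) * M s₀ * N, by positivity, hBM _ hws, fun x => ?_,
        hlow s₀ le_rfl hsR _ _ (by positivity) le_rfl ?_⟩
      · rw [mul_assoc _ N]
        refine (hBM _ hws _).trans ?_
        gcongr
        exact (Rop 0).le_opNorm x
      · calc (1 + K) * M s₀ * N = (1 + K) * (N * s₀) * (M s₀ / s₀) := by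
              field_simp
          _ ≤ _ := by
            gcongr <;> linarith
  refine ContinuousLinearMap.opNorm_le_bound _ (by positivity) fun x => ?_
  have hfin := norm_semigroup_le_of_momentLaplace_le hT hK ht0 (by positivity) (hmain x)
  simp only [ContinuousLinearMap.comp_apply, neg_apply, map_neg, norm_neg]
  have h1 : ‖T t (Rop 0 x)‖ ≤
      Real.exp 1 * K ^ 2 * ((m + 1).factorial * C₂) * 2 ^ (m + 1) / R * ‖x‖ := by
    refine le_of_mul_le_mul_right (hfin.trans_eq ?_) (show 0 < (t / 2) ^ (m + 1) by positivity)
    rw [div_pow]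
    field_simp
  refine h1.trans ?_
  gcongr
  linarith

end
end

section
/- Let X be a complex Banach space and let A be the generator of a C₀-semigroup (T(t))_{t≥0} on X. Suppose that 0 ∈ σ(A) ⊆ {z ∈ ℂ : Re z < 0} ∪ {0} and that M : [1,∞) → (0,∞) is a continuous non-decreasing function such that, for some δ ∈ (0,1], δ·M(s) ≤ sup_{s⁻¹ ≤ |r| ≤ 1} 1/dist(ir, σ(A)) ≤ sup_{s⁻¹ ≤ |r| ≤ 1} ‖R(ir,A)‖ ≤ M(s) for all s ≥ 1. If ‖T(t)AR(1,A)‖ = O(1/M⁻¹(ct)) as t → ∞ for some c > 0, then M has positive increase. -/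
open Filter Topology MeasureTheory

noncomputable section

section Semigroup

variable {X : Type*} [NormedAddCommGroup X] [NormedSpace ℂ X]

theorem not_mem_pmSpectrum_of_isUnit (A : X →ₗ.[ℂ] X) (w : ℂ) (Q U : X →L[ℂ] X) (hU : IsUnit U)
    (hdom : ∀ x, Q x ∈ A.domain)
    (hright : ∀ x, w • Q x - A ⟨Q x, hdom x⟩ = U x)
    (hleft : ∀ x : A.domain, Q (w • (x : X) - A x) = U x) :
    w ∉ pmSpectrum A := by
  obtain ⟨u, rfl⟩ := hU
  have hu1 : ∀ x, (u : X →L[ℂ] X) ((↑u⁻¹ : X →L[ℂ] X) x) = x := fun x =>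
    congrArg (fun S : X →L[ℂ] X => S x) u.mul_inv
  have hu2 : ∀ x, (↑u⁻¹ : X →L[ℂ] X) ((u : X →L[ℂ] X) x) = x := fun x =>
    congrArg (fun S : X →L[ℂ] X => S x) u.inv_mul
  have hr : ∀ x, w • Q ((↑u⁻¹ : X →L[ℂ] X) x) - A ⟨Q ((↑u⁻¹ : X →L[ℂ] X) x), hdom _⟩ = x :=
    fun x => by rw [hright, hu1]
  have hcomm : ∀ x, Q ((↑u⁻¹ : X →L[ℂ] X) x) = (↑u⁻¹ : X →L[ℂ] X) (Q x) := fun x => by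
    have h := hleft ⟨Q ((↑u⁻¹ : X →L[ℂ] X) x), hdom _⟩
    rw [hr] at h
    rw [h, hu2]
  intro hw
  refine hw ⟨Q ∘L (↑u⁻¹ : X →L[ℂ] X), fun x => hdom _, hr, fun x => ?_⟩
  rw [ContinuousLinearMap.comp_apply, hcomm, hleft, hu2]

theorem IsResolvent.one_le_mul_norm [CompleteSpace X] {A : X →ₗ.[ℂ] X} {z w : ℂ}
    {R : X →L[ℂ] X} (hR : IsResolvent A z R) (hw : w ∈ pmSpectrum A) :
    1 ≤ ‖z - w‖ * ‖R‖ := by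
  by_contra! hlt
  have hU : IsUnit (1 - (z - w) • R) :=
    isUnit_one_sub_of_norm_lt_one (by rwa [norm_smul])
  refine not_mem_pmSpectrum_of_isUnit A w R _ hU hR.mem_domain (fun x => ?_) (fun x => ?_) hw
  · have h := hR.right_inv x
    have h2 : A ⟨R x, hR.mem_domain x⟩ = z • R x - x := by
      rw [← sub_eq_zero] at h ⊢
      rw [← neg_eq_zero, ← h]; abel
    rw [h2]
    simp only [sub_apply, one_apply_eq_self,
      smul_apply]
    module
  · have h := hR.left_inv x
    rw [map_sub, map_smul] at h ⊢
    simp only [sub_apply, one_apply_eq_self,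
      smul_apply]
    linear_combination (norm := module) h

theorem IsC0Semigroup.continuous_max {T : ℝ → X →L[ℂ] X} (hT : IsC0Semigroup T) (x : X) :
    Continuous fun s : ℝ => T (max s 0) x :=
  (hT.strong_continuity x).comp_continuous (by fun_prop) fun s => le_max_right s 0

theorem IsC0Semigroup.exists_norm_le [CompleteSpace X] {T : ℝ → X →L[ℂ] X}
    (hT : IsC0Semigroup T) (t : ℝ) :
    ∃ C, ∀ s ∈ Set.Icc 0 t, ‖T s‖ ≤ C := by
  obtain ⟨C, hC⟩ := banach_steinhaus (g := fun s : Set.Icc (0 : ℝ) t => T s) fun x => by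
    obtain ⟨C, hC⟩ := isCompact_Icc.exists_bound_of_continuousOn
      ((hT.strong_continuity x).mono (fun s (hs : s ∈ Set.Icc 0 t) => hs.1))
    exact ⟨C, fun s => hC s s.2⟩
  exact ⟨C, fun s hs => hC ⟨s, hs⟩⟩

/-- The integral `x ↦ ∫₀ᵗ T(s) x ds` is a bounded operator. -/
theorem IsC0Semigroup.exists_integral [CompleteSpace X] {T : ℝ → X →L[ℂ] X}
    (hT : IsC0Semigroup T) {t : ℝ} (ht : 0 ≤ t) :
    ∃ B : X →L[ℂ] X, ∀ x, B x = ∫ s in (0 : ℝ)..t, T (max s 0) x := by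
  obtain ⟨C, hC⟩ := hT.exists_norm_le t
  refine ⟨LinearMap.mkContinuous
    { toFun := fun x => ∫ s in (0 : ℝ)..t, T (max s 0) x
      map_add' := fun x y => ?_
      map_smul' := fun a x => ?_ } (C * t) fun x => ?_, fun x => rfl⟩
  · simp only [_root_.map_add]
    exact intervalIntegral.integral_add ((hT.continuous_max x).intervalIntegrable _ _)
      ((hT.continuous_max y).intervalIntegrable _ _)
  · simp only [map_smul, RingHom.id_apply]
    exact intervalIntegral.integral_smul a _
  · have h : ∀ s ∈ Set.uIoc (0 : ℝ) t, ‖T (max s 0) x‖ ≤ C * ‖x‖ := fun s hs => by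
      rw [Set.uIoc_of_le ht] at hs
      rw [max_eq_left hs.1.le]
      exact (T s).le_of_opNorm_le (hC s ⟨hs.1.le, hs.2⟩) x
    have := intervalIntegral.norm_integral_le_of_norm_le_const h
    rw [sub_zero, abs_of_nonneg ht] at this
    calc _ ≤ C * ‖x‖ * t := this
      _ = C * t * ‖x‖ := by ring

/-- There is a bounded `B` (the integral of the semigroup over `[0, t]`) that commutes with the
semigroup and satisfies `A B = T(t) - I`, expressed through difference quotients. -/
theorem IsC0Semigroup.exists_commute_tendsto [CompleteSpace X] {T : ℝ → X →L[ℂ] X}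
    (hT : IsC0Semigroup T) {t : ℝ} (ht : 0 ≤ t) :
    ∃ B : X →L[ℂ] X, (∀ h, 0 ≤ h → ∀ x, T h (B x) = B (T h x)) ∧
      ∀ x, Tendsto (fun h : ℝ => h⁻¹ • (T h (B x) - B x)) (𝓝[>] 0) (𝓝 (T t x - x)) := by
  obtain ⟨B, hB⟩ := hT.exists_integral ht
  have happ : ∀ h, 0 ≤ h → ∀ x, T h (B x) = ∫ s in (0 : ℝ)..t, T (max (h + s) 0) x := by
    intro h hh x
    rw [hB, ← ContinuousLinearMap.intervalIntegral_comp_comm _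
      ((hT.continuous_max x).intervalIntegrable _ _)]
    refine intervalIntegral.integral_congr fun s hs => ?_
    rw [Set.uIcc_of_le ht] at hs
    rw [max_eq_left hs.1, max_eq_left (add_nonneg hh hs.1), hT.map_add h s hh hs.1]
    rfl
  refine ⟨B, fun h hh x => ?_, fun x => ?_⟩
  · rw [happ h hh, hB]
    refine intervalIntegral.integral_congr fun s hs => ?_
    rw [Set.uIcc_of_le ht] at hs
    rw [max_eq_left hs.1, max_eq_left (add_nonneg hh hs.1), add_comm, hT.map_add s h hs.1 hh]
    rfl
  · have hcont := hT.continuous_max x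
    have hder : ∀ u : ℝ, HasDerivAt (fun v => ∫ s in (0 : ℝ)..v, T (max s 0) x)
        (T (max u 0) x) u := fun u => hcont.integral_hasStrictDerivAt 0 u |>.hasDerivAt
    have h1 := (hder t).tendsto_slope_zero_right
    have h2 := (hder 0).tendsto_slope_zero_right
    have h3 := h1.sub h2
    rw [max_eq_left ht, max_self, hT.map_zero, one_apply_eq_self] at h3
    refine h3.congr' ?_
    filter_upwards [self_mem_nhdsWithin] with h hh
    rw [← smul_sub, happ h (le_of_lt hh), hB,
      intervalIntegral.integral_comp_add_left (fun s => T (max s 0) x) h, add_zero, zero_add,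
      intervalIntegral.integral_same, sub_zero, add_comm h t,
      ← intervalIntegral.integral_add_adjacent_intervals (a := (0 : ℝ)) (b := h) (c := t + h)
        (hcont.intervalIntegrable _ _) (hcont.intervalIntegrable _ _)]
    congr 1
    abel

theorem IsC0Semigroup.exp_smul {T : ℝ → X →L[ℂ] X} (hT : IsC0Semigroup T) (z : ℂ) :
    IsC0Semigroup fun t : ℝ => Complex.exp (-z * t) • T t where
  map_zero := by simp [hT.map_zero]
  map_add s t hs ht := by
    rw [hT.map_add s t hs ht]
    ext x
    simp [smul_smul, mul_add, Complex.exp_add, mul_comm]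
  strong_continuity x := by
    have h := hT.strong_continuity x
    simp only [smul_apply]
    exact ContinuousOn.smul (by fun_prop) h

theorem tendsto_exp_smul_iff {T : ℝ → X →L[ℂ] X} (z : ℂ) {y v : X} :
    Tendsto (fun h : ℝ => h⁻¹ • ((Complex.exp (-z * h) • T h) y - y)) (𝓝[>] 0) (𝓝 v) ↔
      Tendsto (fun h : ℝ => h⁻¹ • (T h y - y)) (𝓝[>] 0) (𝓝 (v + z • y)) := by
  have hexp : ∀ a : ℂ, Tendsto (fun h : ℝ => Complex.exp (a * h)) (𝓝[>] 0) (𝓝 1) := fun a => by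
    have : Continuous fun h : ℝ => Complex.exp (a * h) := by fun_prop
    have := this.tendsto 0
    simp only [Complex.ofReal_zero, mul_zero, Complex.exp_zero] at this
    exact this.mono_left nhdsWithin_le_nhds
  have hquot : ∀ a : ℂ, Tendsto (fun h : ℝ => h⁻¹ • (Complex.exp (a * h) - 1))
      (𝓝[>] 0) (𝓝 a) := fun a => by
    have h1 : HasDerivAt (fun h : ℝ => Complex.exp (a * h)) a 0 := by
      have h2 : HasDerivAt (fun h : ℝ => a * (h : ℂ)) a 0 := by
        simpa using (Complex.ofRealCLM.hasDerivAt (x := (0 : ℝ))).const_mul a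
      simpa using h2.cexp
    simpa using h1.tendsto_slope_zero_right
  constructor
  · intro H
    have h1 := ((hexp z).smul H).add ((hquot z).smul_const y)
    rw [one_smul] at h1
    refine h1.congr fun h => ?_
    have he : Complex.exp (z * h) * Complex.exp (-z * h) = 1 := by
      rw [← Complex.exp_add]; simp
    rw [smul_apply, smul_comm (Complex.exp (z * h)), smul_assoc, ← smul_add,
      smul_sub, smul_smul, he, one_smul, sub_smul, one_smul]
    congr 1
    abel
  · intro H
    have h1 := ((hexp (-z)).smul H).add ((hquot (-z)).smul_const y)
    have h2 : (1 : ℂ) • (v + z • y) + -z • y = v := by module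
    rw [h2] at h1
    refine h1.congr fun h => ?_
    rw [smul_apply, smul_comm (Complex.exp (-z * h)), smul_assoc, ← smul_add,
      smul_sub, sub_smul, one_smul]
    congr 1
    abel

/-- For `z ≠ 1` in the spectrum of `A`, the number `e^{tz} z / (1 - z)` is dominated by the norm
of `T(t) A R(1, A)`: this is the spectral inclusion theorem. -/
theorem IsGenerator.norm_le_of_mem_pmSpectrum [CompleteSpace X] {T : ℝ → X →L[ℂ] X}
    (hT : IsC0Semigroup T) {A : X →ₗ.[ℂ] X} (hA : IsGenerator T A) {R : X →L[ℂ] X}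
    (hR : IsResolvent A 1 R) {z : ℂ} (hz : z ∈ pmSpectrum A) {t : ℝ} (ht : 0 ≤ t) :
    ‖Complex.exp (t * z) * (z / (1 - z))‖ ≤ ‖T t ∘L (R - 1)‖ := by
  have hz1 : 1 - z ≠ 0 := fun h => hz ⟨R, by rwa [← sub_eq_zero.1 h]⟩
  by_contra! hlt
  set μ := Complex.exp (t * z) * (z / (1 - z)) with hμ
  have hres : IsUnit (algebraMap ℂ (X →L[ℂ] X) μ - T t ∘L (R - 1)) := by
    have h1 : ‖(1 : X →L[ℂ] X)‖ ≤ 1 := ContinuousLinearMap.norm_id_le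
    exact spectrum.mem_resolventSet_of_norm_lt_mul
      ((mul_le_of_le_one_right (norm_nonneg _) h1).trans_lt hlt)
  have he : Complex.exp (-z * t) * Complex.exp (t * z) = 1 := by
    rw [← Complex.exp_add, ← Complex.exp_zero]; congr 1; ring
  have hU : IsUnit (Complex.exp (-z * t) • (algebraMap ℂ (X →L[ℂ] X) μ - T t ∘L (R - 1))) := by
    have := hres.smul (Units.mk0 _ (Complex.exp_ne_zero (-z * t)))
    exact this
  have hW := hT.exp_smul z
  obtain ⟨B, hcomm, hB⟩ := hW.exists_commute_tendsto ht
  have hBt : ∀ x, Tendsto (fun h : ℝ => h⁻¹ • (T h (B x) - B x)) (𝓝[>] 0)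
      (𝓝 ((Complex.exp (-z * t) • T t) x - x + z • B x)) :=
    fun x => (tendsto_exp_smul_iff z).1 (hB x)
  have hBdom : ∀ x, B x ∈ A.domain := fun x => (hA.mem_domain_iff _).2 ⟨_, hBt x⟩
  have hAB : ∀ x, A ⟨B x, hBdom x⟩ = (Complex.exp (-z * t) • T t) x - x + z • B x :=
    fun x => tendsto_nhds_unique (hA.tendsto_generator ⟨B x, hBdom x⟩) (hBt x)
  have hBA : ∀ x : A.domain, B (z • (x : X) - A x) = x - (Complex.exp (-z * t) • T t) x := by
    intro x
    have h1 : Tendsto (fun h : ℝ => h⁻¹ • ((Complex.exp (-z * h) • T h) (x : X) - x)) (𝓝[>] 0)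
        (𝓝 (A x - z • (x : X))) := by
      rw [tendsto_exp_smul_iff, sub_add_cancel]
      exact hA.tendsto_generator x
    have h2 := (B.continuous.tendsto _).comp h1
    have h3 := tendsto_nhds_unique (h2.congr' ?_) (hB x)
    · rw [← neg_sub (A x), map_neg, h3, neg_sub]
    · filter_upwards [self_mem_nhdsWithin] with h hh
      have h4 := hcomm h (le_of_lt hh) x
      simp only [Function.comp_apply]
      rw [B.map_smul_of_tower, map_sub, ← h4]
  have hAR : ∀ x, A ⟨R x, hR.mem_domain x⟩ = R x - x := fun x => by
    have h := hR.right_inv x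
    rw [one_smul] at h
    linear_combination (norm := module) -h
  have hRA : ∀ x : A.domain, R (A x) = R x - x := fun x => by
    have h := hR.left_inv x
    rw [one_smul, map_sub] at h
    linear_combination (norm := module) -h
  have hexp : ∀ x, (Complex.exp (-z * t) • (algebraMap ℂ (X →L[ℂ] X) μ - T t ∘L (R - 1)) : X →L[ℂ] X) x
      = (z / (1 - z)) • x - (Complex.exp (-z * t) • T t) (R x - x) := fun x => by
    have : Complex.exp (-z * t) * μ = z / (1 - z) := by rw [hμ, ← mul_assoc, he, one_mul]
    simp only [smul_apply, sub_apply,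
      Algebra.algebraMap_eq_smul_one, one_apply_eq_self,
      ContinuousLinearMap.comp_apply, smul_sub, smul_smul, this]
  have hdom : ∀ x, ((1 - z)⁻¹ • R + B ∘L (R - 1) : X →L[ℂ] X) x ∈ A.domain := fun x =>
    A.domain.add_mem (A.domain.smul_mem _ (hR.mem_domain x)) (hBdom _)
  have hzz : (1 - z)⁻¹ * (1 - z) = 1 := inv_mul_cancel₀ hz1
  refine not_mem_pmSpectrum_of_isUnit A z ((1 - z)⁻¹ • R + B ∘L (R - 1)) _ hU hdom
    (fun x => ?_) (fun x => ?_) hz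
  · have h1 : (⟨((1 - z)⁻¹ • R + B ∘L (R - 1) : X →L[ℂ] X) x, hdom x⟩ : A.domain) =
        (1 - z)⁻¹ • ⟨R x, hR.mem_domain x⟩ + ⟨B (R x - x), hBdom _⟩ := rfl
    have h2 : ((1 - z)⁻¹ • R + B ∘L (R - 1) : X →L[ℂ] X) x = (1 - z)⁻¹ • R x + B (R x - x) := rfl
    rw [h1, LinearPMap.map_add, LinearPMap.map_smul, hAR, hAB, h2, hexp]
    generalize (Complex.exp (-z * t) • T t) (R x - x) = y
    generalize B (R x - x) = b
    rw [div_eq_mul_inv]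
    match_scalars <;> field_simp <;> ring
  · have h2 : ∀ x, ((1 - z)⁻¹ • R + B ∘L (R - 1) : X →L[ℂ] X) x = (1 - z)⁻¹ • R x + B (R x - x) :=
      fun x => rfl
    have h3 : R (z • (x : X) - A x) = (z - 1) • R x + x := by
      rw [map_sub, map_smul, hRA]; module
    have h4 := hBA (⟨R x, hR.mem_domain x⟩ - x)
    rw [LinearPMap.map_sub, hAR] at h4
    have h5 : R (z • (x : X) - A x) - (z • (x : X) - A x) =
        z • (((⟨R x, hR.mem_domain x⟩ - x : A.domain)) : X) - (R x - x - A x) := by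
      rw [h3, Submodule.coe_sub]; module
    rw [h2, h5, h4, h3, hexp, Submodule.coe_sub]
    generalize (Complex.exp (-z * t) • T t) (R x - x) = y
    rw [div_eq_mul_inv]
    match_scalars <;> field_simp <;> ring

end Semigroup

theorem hasPosIncrease_of_two_mul_le {M : ℝ → ℝ} {a B s₀ : ℝ} (hB : 1 < B) (has : a ≤ s₀)
    (hs₀ : 0 < s₀) (hpos : ∀ s, a ≤ s → 0 < M s) (hmono : ∀ s t, a ≤ s → s ≤ t → M s ≤ M t)
    (hdouble : ∀ s, s₀ ≤ s → 2 * M s ≤ M (B * s)) : HasPosIncrease a M := by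
  have hlogB : 0 < Real.log B := Real.log_pos hB
  have hB0 : 0 < B := one_pos.trans hB
  have hpow : ∀ n : ℕ, ∀ s, s₀ ≤ s → s₀ ≤ B ^ n * s ∧ 2 ^ n * M s ≤ M (B ^ n * s) := by
    intro n
    induction n with
    | zero => intro s hs; simpa using hs
    | succ n ih =>
      intro s hs
      obtain ⟨h1, h2⟩ := ih s hs
      have h3 := hdouble _ h1
      rw [← mul_assoc, ← pow_succ'] at h3
      refine ⟨?_, ?_⟩
      · rw [pow_succ', mul_assoc]
        nlinarith
      · rw [pow_succ]
        linarith
  refine ⟨Real.log 2 / Real.log B, div_pos (Real.log_pos one_lt_two) hlogB, 1 / 2,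
    ⟨by norm_num, by norm_num⟩, s₀, has, hs₀, fun lam hlam s hs => ?_⟩
  have hlam0 : 0 < lam := one_pos.trans_le hlam
  have hsa : a ≤ s := has.trans hs
  rw [le_div_iff₀ (hpos s hsa)]
  set n := ⌊Real.log lam / Real.log B⌋₊ with hn
  have hn1 : (n : ℝ) ≤ Real.log lam / Real.log B :=
    Nat.floor_le (div_nonneg (Real.log_nonneg hlam) hlogB.le)
  have hn2 : Real.log lam / Real.log B < n + 1 := Nat.lt_floor_add_one _
  have hBn : B ^ n ≤ lam := by
    rw [← Real.log_le_log_iff (by positivity) hlam0, Real.log_pow]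
    exact (le_div_iff₀ hlogB).1 hn1
  have hle : lam ^ (Real.log 2 / Real.log B) ≤ 2 ^ (n + 1) := by
    rw [← Real.log_le_log_iff (by positivity) (by positivity), Real.log_rpow hlam0, Real.log_pow]
    have := mul_le_mul_of_nonneg_right hn2.le (Real.log_pos one_lt_two).le
    push_cast
    calc _ = Real.log lam / Real.log B * Real.log 2 := by ring
      _ ≤ _ := this
  obtain ⟨h1, h2⟩ := hpow n s hs
  calc 1 / 2 * lam ^ (Real.log 2 / Real.log B) * M s
      ≤ 1 / 2 * 2 ^ (n + 1) * M s := by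
        have := (hpos s hsa).le
        gcongr
    _ = 2 ^ n * M s := by ring
    _ ≤ M (B ^ n * s) := h2
    _ ≤ M (lam * s) := hmono _ _ (has.trans h1)
        (mul_le_mul_of_nonneg_right hBn (hs₀.le.trans hs))

theorem bddAbove_range_of_iSup_pos {ι : Sort*} {f : ι → ℝ} (h : 0 < ⨆ i, f i) :
    BddAbove (Set.range f) := by
  by_contra hb
  rw [Real.iSup_of_not_bddAbove hb] at h
  exact h.false

/-- Let `X` be a complex Banach space and `A` the generator of a
`C₀`-semigroup `(T(t))` on `X`. Suppose `0 ∈ σ(A) ⊆ {Re z < 0} ∪ {0}` and that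
`M : [1,∞) → (0,∞)` is continuous non-decreasing with, for some `δ ∈ (0,1]`,
`δ M s ≤ sup_{s⁻¹ ≤ |r| ≤ 1} dist(i r, σ(A))⁻¹ ≤ sup_{s⁻¹ ≤ |r| ≤ 1} ‖R(i r, A)‖ ≤ M s`
for all `s ≥ 1`. If `‖T(t) A R(1,A)‖ = O(1 / M⁻¹ (c t))` as `t → ∞` for some `c > 0`,
then `M` has positive increase. (Note `A R(1,A) = R(1,A) - I`.) -/
theorem statement6 {X : Type*} [NormedAddCommGroup X] [NormedSpace ℂ X] [CompleteSpace X]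
    (T : ℝ → X →L[ℂ] X) (hT : IsC0Semigroup T)
    (A : X →ₗ.[ℂ] X) (hA : IsGenerator T A)
    (hzero : (0 : ℂ) ∈ pmSpectrum A)
    (hspec : pmSpectrum A ⊆ {z : ℂ | z.re < 0} ∪ {0})
    (Rop : ℝ → X →L[ℂ] X)
    (hRop : ∀ r : ℝ, r ≠ 0 → IsResolvent A (Complex.I * (r : ℂ)) (Rop r))
    (R1 : X →L[ℂ] X) (hR1 : IsResolvent A 1 R1)
    (M : ℝ → ℝ)
    (hMpos : ∀ s : ℝ, 1 ≤ s → 0 < M s)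
    (hMcont : ContinuousOn M (Set.Ici (1 : ℝ)))
    (hMmono : ∀ s t : ℝ, 1 ≤ s → s ≤ t → M s ≤ M t)
    (δ : ℝ) (hδ : δ ∈ Set.Ioc (0 : ℝ) 1)
    (hchain : ∀ s : ℝ, 1 ≤ s →
      δ * M s ≤
          (⨆ r : {r : ℝ // s⁻¹ ≤ |r| ∧ |r| ≤ 1},
            (Metric.infDist (Complex.I * ((r : ℝ) : ℂ)) (pmSpectrum A))⁻¹) ∧
      (⨆ r : {r : ℝ // s⁻¹ ≤ |r| ∧ |r| ≤ 1},
            (Metric.infDist (Complex.I * ((r : ℝ) : ℂ)) (pmSpectrum A))⁻¹) ≤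
          (⨆ r : {r : ℝ // s⁻¹ ≤ |r| ∧ |r| ≤ 1}, ‖Rop (r : ℝ)‖) ∧
      (⨆ r : {r : ℝ // s⁻¹ ≤ |r| ∧ |r| ≤ 1}, ‖Rop (r : ℝ)‖) ≤ M s)
    (c : ℝ) (hc : 0 < c)
    (hO : ∃ C : ℝ, 0 < C ∧ ∃ t₀ : ℝ, ∀ t : ℝ, t₀ ≤ t →
      ‖T t ∘L (R1 - 1)‖ ≤ C / rcInv 1 M (c * t)) :
    HasPosIncrease 1 M := by
  obtain ⟨hδ0, hδ1⟩ := hδ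
  have hsM : ∀ s : ℝ, 1 ≤ s → s ≤ M s := by
    intro s hs
    have hs0 : 0 < s := one_pos.trans_le hs
    obtain ⟨h1, h2, h3⟩ := hchain s hs
    have hbdd := bddAbove_range_of_iSup_pos ((mul_pos hδ0 (hMpos s hs)).trans_le (h1.trans h2))
    have hmem : s⁻¹ ≤ |s⁻¹| ∧ |s⁻¹| ≤ 1 :=
      ⟨le_abs_self _, by rw [abs_of_pos (inv_pos.2 hs0)]; exact inv_le_one_of_one_le₀ hs⟩
    have h4 := (le_ciSup hbdd ⟨s⁻¹, hmem⟩).trans h3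
    have h5 := (hRop s⁻¹ (inv_pos.2 hs0).ne').one_le_mul_norm hzero
    rw [sub_zero, norm_mul, Complex.norm_I, one_mul, Complex.norm_real, Real.norm_eq_abs,
      abs_of_pos (inv_pos.2 hs0), inv_mul_eq_div, le_div_iff₀ hs0, one_mul] at h5
    exact h5.trans h4
  obtain ⟨C, hC, t₀, hO⟩ := hO
  set K := 3 / δ with hK
  have hK0 : 0 < K := by positivity
  set E := Real.exp (2 * K / c) with hE
  have hE0 : 0 < E := Real.exp_pos _
  set B := 4 * K + 2 * C * (2 + K) * E + 2 with hBdef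
  have hB1 : 1 < B := by
    have : 0 < 2 * C * (2 + K) * E := by positivity
    linarith
  refine hasPosIncrease_of_two_mul_le (s₀ := max 1 (c * t₀ / 2)) hB1 (le_max_left _ _)
    (one_pos.trans_le (le_max_left _ _)) hMpos hMmono fun s hs => ?_
  have hs1 : 1 ≤ s := (le_max_left _ _).trans hs
  have hs0 : 0 < s := one_pos.trans_le hs1
  have hMs := hsM s hs1
  have hM0 := hMpos s hs1
  have hBs : s ≤ B * s := le_mul_of_one_le_left hs0.le hB1.le
  have hMBs := hsM (B * s) (hs1.trans hBs)
  have hBK : 4 * K ≤ B := by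
    have : 0 < 2 * C * (2 + K) * E := by positivity
    linarith
  by_cases hcase : M s < 2 * K * s
  · nlinarith
  push Not at hcase
  obtain ⟨z, hz, r, hr, hr1, hzr⟩ : ∃ z ∈ pmSpectrum A, ∃ r : ℝ, s⁻¹ ≤ |r| ∧ |r| ≤ 1 ∧
      ‖Complex.I * r - z‖ < K / M s := by
    have h1 := (hchain s hs1).1
    have hlt : δ * M s / 2 < δ * M s := half_lt_self (mul_pos hδ0 hM0)
    have : Nonempty {r : ℝ // s⁻¹ ≤ |r| ∧ |r| ≤ 1} :=
      ⟨⟨1, by rw [abs_one]; exact ⟨inv_le_one_of_one_le₀ hs1, le_rfl⟩⟩⟩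
    obtain ⟨⟨r, hr, hr1⟩, h2⟩ := exists_lt_of_lt_ciSup (hlt.trans_le h1)
    have h3 : Metric.infDist (Complex.I * r) (pmSpectrum A) < K / M s := by
      have hpos : 0 < δ * M s / 2 := by positivity
      have h4 := inv_strictAnti₀ hpos h2
      rw [inv_inv] at h4
      refine h4.trans ?_
      rw [hK, div_div, inv_div]
      gcongr
      norm_num
    obtain ⟨z, hz, hd⟩ := (Metric.infDist_lt_iff ⟨0, hzero⟩).1 h3
    exact ⟨z, hz, r, hr, hr1, by rwa [← dist_eq_norm]⟩
  have hnr : ‖Complex.I * (r : ℂ)‖ = |r| := by simp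
  have hKM : K / M s ≤ s⁻¹ / 2 := by
    rw [div_le_iff₀ hM0]
    calc K = s⁻¹ / 2 * (2 * K * s) := by field_simp
      _ ≤ _ := by gcongr
  have hzlow : s⁻¹ / 2 ≤ ‖z‖ := by
    have := norm_sub_norm_le (Complex.I * (r : ℂ)) z
    linarith
  have hzup : ‖1 - z‖ ≤ 2 + K := by
    have h1 : K / M s ≤ K := div_le_self hK0.le (hs1.trans hMs)
    have h2 : ‖1 - z‖ ≤ ‖(1 : ℂ)‖ + ‖Complex.I * (r : ℂ) - z‖ + ‖Complex.I * (r : ℂ)‖ := by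
      have : 1 - z = 1 + (Complex.I * (r : ℂ) - z) - Complex.I * (r : ℂ) := by ring
      rw [this]
      exact (norm_sub_le _ _).trans (add_le_add_left (norm_add_le _ _) _)
    rw [norm_one, hnr] at h2
    linarith
  have hz1 : 0 < ‖1 - z‖ := norm_pos_iff.2 fun h => hz ⟨R1, by rwa [← sub_eq_zero.1 h]⟩
  have hre : -(K / M s) ≤ z.re := by
    have h1 := (Complex.abs_re_le_norm (Complex.I * (r : ℂ) - z)).trans hzr.le
    have h2 : (Complex.I * (r : ℂ) - z).re = -z.re := by simp
    rw [h2, abs_neg] at h1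
    exact neg_le_of_abs_le h1
  by_contra! hcon
  set t := 2 * M s / c with ht
  have ht0 : 0 ≤ t := by positivity
  have htt : t₀ ≤ t := by
    rw [ht, le_div_iff₀ hc]
    have := (le_max_right _ _).trans hs
    linarith
  have hct : c * t = 2 * M s := by rw [ht]; field_simp
  have hinv : B * s ≤ rcInv 1 M (c * t) :=
    le_csSup ⟨c * t, fun r hr => (hsM r hr.1).trans hr.2⟩ ⟨hs1.trans hBs, by rw [hct]; exact hcon.le⟩
  have hBs0 : 0 < B * s := hs0.trans_le hBs
  have hup := (hA.norm_le_of_mem_pmSpectrum hT hR1 hz ht0).trans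
    ((hO t htt).trans (div_le_div_of_nonneg_left hC.le hBs0 hinv))
  have hexp : E⁻¹ ≤ ‖Complex.exp (t * z)‖ := by
    rw [Complex.norm_exp, hE, ← Real.exp_neg, Real.exp_le_exp, Complex.re_ofReal_mul]
    calc -(2 * K / c) = t * -(K / M s) := by rw [ht]; field_simp
      _ ≤ _ := by gcongr
  have hlow : E⁻¹ * ((s⁻¹ / 2) / (2 + K)) ≤ C / (B * s) := by
    refine le_trans ?_ hup
    rw [norm_mul, norm_div]
    gcongr
  rw [le_div_iff₀ hBs0] at hlow
  have hfin : B ≤ 2 * C * (2 + K) * E := by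
    calc B = E⁻¹ * ((s⁻¹ / 2) / (2 + K)) * (B * s) * (2 * (2 + K) * E) := by field_simp
      _ ≤ C * (2 * (2 + K) * E) := by gcongr
      _ = _ := by ring
  linarith

end
end
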